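/- For any multiplicative characters A, B, B', C of F_q and any x ∈ F_q, one has (1/(q−1)²)·Σ_{λ,μ} binom(B̄B̄'C, B̄'Cλ)·binom(Aλ, λ)·binom(Aλμ, μ)·binom(B̄'Cλ, Cλμ)·λ(−x)·μ(−1) = AB'(−1)·binom(B', ĀC)·₂F₁(A, B; CB̄'; x), where the double sum ranges over all multiplicative characters λ, μ of F_q. -/

import Mathlib

open Finset

namespace FFAppell

variable {F : Type*} [Field F] [Fintype F] [DecidableEq F]

/-- The multiplicative characters of a finite field form a finite type. -/
noncomputable instance : Fintype (MulChar F ℂ) := Fintype.ofFinite _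

/-- The Jacobi sum `J(χ, λ) = Σ_{u ∈ F} χ(u)·λ(1−u)`. -/
noncomputable def J (χ lam : MulChar F ℂ) : ℂ := ∑ u : F, χ u * lam (1 - u)

/-- The binomial coefficient `binom(A, B) := B(−1)·J(A, B̄)`. -/
noncomputable def binom (A B : MulChar F ℂ) : ℂ := B (-1) * J A B⁻¹

/-- `δ(χ) = 1` if `χ` is the trivial character, `0` otherwise. -/
noncomputable def δchar (χ : MulChar F ℂ) : ℂ := if χ = 1 then 1 else 0

/-- `δ(x) = 1` if `x = 0`, `0` otherwise. -/
def δ (x : F) : ℂ := if x = 0 then 1 else 0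

/-- The finite-field Gauss hypergeometric function
`₂F₁(A, B; C; x) := ε(x)·BC(−1)·Σ_{y ∈ F} B(y)·B̄C(1−y)·Ā(1−xy)`,
where `ε = 1` is the trivial character (with `ε 0 = 0`). -/
noncomputable def twoF1 (A B C : MulChar F ℂ) (x : F) : ℂ :=
  (1 : MulChar F ℂ) x * (B * C) (-1) *
    ∑ y : F, B y * (B⁻¹ * C) (1 - y) * A⁻¹ (1 - x * y)

/-- The finite-field `₃F₂` function:
`₃F₂(A₀,A₁,A₂; B₁,B₂; x) := (1/(q−1))·Σ_χ binom(A₀χ,χ)·binom(A₁χ,B₁χ)·binom(A₂χ,B₂χ)·χ(x)`. -/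
noncomputable def threeF2 (A₀ A₁ A₂ B₁ B₂ : MulChar F ℂ) (x : F) : ℂ :=
  (1 / ((Fintype.card F : ℂ) - 1)) *
    ∑ χ : MulChar F ℂ, binom (A₀ * χ) χ * binom (A₁ * χ) (B₁ * χ) *
      binom (A₂ * χ) (B₂ * χ) * χ x

/-- The finite-field Appell function `F₁(A; B, B'; C; x, y)`:
`ε(xy)·BB'(−1)·Σ_{u,v ∈ F} B(u)·B'(v)·(C·B̄·B̄')(1−u−v)·Ā(1−ux−vy)`. -/
noncomputable def AppellF1 (A B B' C : MulChar F ℂ) (x y : F) : ℂ :=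
  (1 : MulChar F ℂ) (x * y) * (B * B') (-1) *
    ∑ u : F, ∑ v : F,
      B u * B' v * (C * B⁻¹ * B'⁻¹) (1 - u - v) * A⁻¹ (1 - u * x - v * y)

set_option linter.unusedSectionVars false

/-- The sum of `χ a` over all multiplicative characters `χ` of a finite field. -/
lemma sum_mulChar_apply (a : F) :
    ∑ χ : MulChar F ℂ, χ a = if a = 1 then (Fintype.card F : ℂ) - 1 else 0 := by
  split_ifs with ha
  · have h := MulChar.card_eq_card_units_of_hasEnoughRootsOfUnity F ℂ
    rw [Nat.card_eq_fintype_card, Nat.card_eq_fintype_card, Fintype.card_units] at h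
    simp [ha, h, Nat.cast_sub Fintype.card_pos]
  · obtain ⟨χ, hχ⟩ := MulChar.exists_apply_ne_one_of_hasEnoughRootsOfUnity F ℂ ha
    refine eq_zero_of_mul_eq_self_left hχ ?_
    simp only [Finset.mul_sum, ← MulChar.mul_apply]
    exact Fintype.sum_bijective _ (Group.mulLeft_bijective χ) _ _ fun χ' ↦ rfl

lemma mulChar_neg_one_mul_self (χ : MulChar F ℂ) : χ (-1) * χ (-1) = 1 := by
  rw [← map_mul]; simp

lemma mulChar_inv_neg_one (χ : MulChar F ℂ) : χ⁻¹ (-1) = χ (-1) := by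
  rw [MulChar.inv_apply', inv_neg_one]

/-- Reparametrization of a Jacobi sum by `u = 1 - y⁻¹`. -/
lemma J_inv_eq_sum (P S : MulChar F ℂ) : J P S⁻¹ = ∑ y : F, P (1 - y⁻¹) * S y := by
  refine (Fintype.sum_equiv ((Equiv.ofBijective _ (inv_involutive (G := F)).bijective).trans (Equiv.subLeft 1)) _ _ fun y ↦ ?_).symm
  simp [MulChar.inv_apply']

/-- The reflection formula for Jacobi sums. -/
lemma J_reflection (P S : MulChar F ℂ) : J P S = P (-1) * J P (P * S)⁻¹ := by
  rw [J_inv_eq_sum, mul_sum]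
  refine Fintype.sum_equiv (Equiv.subLeft 1) _ _ fun u ↦ ?_
  rcases eq_or_ne u 1 with rfl | hu
  · simp [MulChar.map_zero]
  have hu' : 1 - u ≠ 0 := sub_ne_zero.mpr hu.symm
  have h : u = -1 * ((1 - (1 - u)⁻¹) * (1 - u)) := by field_simp; ring
  simp only [Equiv.subLeft_apply, MulChar.mul_apply]
  nth_rewrite 1 [h]
  simp only [map_mul]
  ring

/-- Summation over `u` of a character on the locus cut out by orthogonality. -/
lemma sum_mulChar_ite (R : MulChar F ℂ) {t : F} (ht : t ≠ 0) (c : ℂ) :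
    ∑ u : F, R u * (if -t * u * (1 - u)⁻¹ = 1 then c else 0) = R⁻¹ (1 - t) * c := by
  rw [MulChar.inv_apply', Finset.sum_eq_single (1 - t)⁻¹]
  · rcases eq_or_ne (1 - t) 0 with h | h
    · simp [h, MulChar.map_zero]
    · rw [if_pos]
      have h1 : 1 - (1 - t)⁻¹ = -t * (1 - t)⁻¹ := by field_simp; ring
      rw [h1]
      exact mul_inv_cancel₀ (mul_ne_zero (neg_ne_zero.mpr ht) (inv_ne_zero h))
  · intro u _ hu
    rw [if_neg, mul_zero]
    intro h
    have h1 : 1 - u ≠ 0 := by rintro h0; simp [h0] at h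
    apply hu
    rw [mul_inv_eq_one₀ h1] at h
    exact eq_inv_of_mul_eq_one_left (by linear_combination h)
  · simp

/-- The character-sum expansion of `₂F₁`. -/
lemma sum_binom_mul_binom (P Q R : MulChar F ℂ) (x : F) :
    ∑ χ : MulChar F ℂ, binom P (Q * χ) * binom (R * χ) χ * χ (-x) =
      ((Fintype.card F : ℂ) - 1) * Q (-1) * twoF1 R (Q * P⁻¹) Q x := by
  rcases eq_or_ne x 0 with rfl | hx
  · simp [twoF1, MulChar.map_zero]
  have expand (χ : MulChar F ℂ) : binom P (Q * χ) * binom (R * χ) χ * χ (-x) =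
      ∑ y : F, ∑ u : F, Q (-1) * (P (1 - y⁻¹) * Q y) * (R u * χ (-(x * y) * u * (1 - u)⁻¹)) := by
    rw [binom, binom, J_inv_eq_sum, J]
    simp only [← mul_sum]
    have e (y u : F) : χ (-(x * y) * u * (1 - u)⁻¹) =
        χ (-1) * χ x * χ y * (χ u * χ⁻¹ (1 - u)) := by
      rw [MulChar.inv_apply', ← map_mul, ← map_mul, ← map_mul, ← map_mul]
      congr 1
      ring
    have e' (y : F) : ∑ u : F, R u * χ (-(x * y) * u * (1 - u)⁻¹) =
        χ (-1) * χ x * χ y * ∑ u : F, (R * χ) u * χ⁻¹ (1 - u) := by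
      rw [mul_sum]
      refine sum_congr rfl fun u _ ↦ ?_
      rw [e, MulChar.mul_apply]
      ring
    have hn : χ (-x) = χ (-1) * χ x := by rw [← map_mul, neg_one_mul]
    simp only [e', ← mul_assoc, ← sum_mul]
    rw [hn, MulChar.mul_apply]
    have hs : ∑ y : F, P (1 - y⁻¹) * (Q * χ) y = ∑ y : F, P (1 - y⁻¹) * Q y * χ y :=
      sum_congr rfl fun y _ ↦ by rw [MulChar.mul_apply, mul_assoc]
    have hs' : ∑ y : F, Q (-1) * P (1 - y⁻¹) * Q y * χ (-1) * χ x * χ y =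
        Q (-1) * χ (-1) * χ x * ∑ y : F, P (1 - y⁻¹) * Q y * χ y := by
      rw [mul_sum]
      exact sum_congr rfl fun y _ ↦ by ring
    rw [hs, hs']
    linear_combination (Q (-1) * χ (-1) * χ x * (∑ y : F, P (1 - y⁻¹) * Q y * χ y) *
      ∑ u : F, (R * χ) u * χ⁻¹ (1 - u)) * mulChar_neg_one_mul_self χ
  simp only [expand]
  rw [sum_comm, twoF1, mul_sum, mul_sum]
  refine sum_congr rfl fun y _ ↦ ?_
  rw [sum_comm]
  simp only [← mul_sum, sum_mulChar_apply]
  rcases eq_or_ne y 0 with rfl | hy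
  · simp [MulChar.map_zero]
  rw [sum_mulChar_ite R (mul_ne_zero hx hy), MulChar.one_apply hx.isUnit]
  have hP : P (1 - y⁻¹) = P (-1) * P (1 - y) * P⁻¹ y := by
    rw [MulChar.inv_apply', ← map_mul, ← map_mul]
    congr 1
    field_simp
    ring
  have hQ : (Q * P⁻¹)⁻¹ * Q = P := by group
  simp only [hP, hQ, MulChar.mul_apply, mulChar_inv_neg_one]
  linear_combination -(((Fintype.card F : ℂ) - 1) * Q (-1) * P (-1) * Q y * P⁻¹ y * P (1 - y) *
    R⁻¹ (1 - x * y)) * mulChar_neg_one_mul_self Q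

/-- The evaluation of `₂F₁` at `1`. -/
lemma twoF1_one (A B C : MulChar F ℂ) :
    twoF1 A B C 1 = (B * C) (-1) * J B (B⁻¹ * C * A⁻¹) := by
  simp only [twoF1, J, one_mul, map_one, MulChar.mul_apply, mul_assoc]

/-- The character double sum at `μ(−1)` reduces to a `₂F₁`. -/
theorem double_sum_at_neg_one (A B B' C : MulChar F ℂ) (x : F) :
    (1 / ((Fintype.card F : ℂ) - 1) ^ 2) *
        ∑ lam : MulChar F ℂ, ∑ mu : MulChar F ℂ,
          binom (B⁻¹ * B'⁻¹ * C) (B'⁻¹ * C * lam) * binom (A * lam) lam *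
            binom (A * lam * mu) mu * binom (B'⁻¹ * C * lam) (C * lam * mu) *
            lam (-x) * mu (-1) =
      (A * B') (-1) * binom B' (A⁻¹ * C) * twoF1 A B (C * B'⁻¹) x := by
  have hB (lam : MulChar F ℂ) : C * lam * (B'⁻¹ * C * lam)⁻¹ = B' := by simp [mul_inv_rev]
  have hA (lam : MulChar F ℂ) : B'⁻¹ * (C * lam) * (A * lam)⁻¹ = B'⁻¹ * C * A⁻¹ := by
    rw [← mul_assoc, ← div_eq_mul_inv, mul_div_mul_right_eq_div, div_eq_mul_inv]
  have hJ : B' * (B'⁻¹ * C * A⁻¹) = A⁻¹ * C := by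
    rw [mul_assoc, mul_inv_cancel_left, mul_comm]
  have hP : B⁻¹ * B'⁻¹ * C = B⁻¹ * (B'⁻¹ * C) := mul_assoc _ _ _
  have hQ : B'⁻¹ * C * (B⁻¹ * (B'⁻¹ * C))⁻¹ = B := by
    rw [mul_inv, inv_inv, mul_left_comm, mul_inv_cancel, mul_one]
  have inner (lam : MulChar F ℂ) : ∑ mu : MulChar F ℂ,
      binom (B'⁻¹ * C * lam) (C * lam * mu) * binom (A * lam * mu) mu * mu (-1) =
        ((Fintype.card F : ℂ) - 1) * J B' (A⁻¹ * C)⁻¹ := by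
    rw [sum_binom_mul_binom, hB, twoF1_one, hA, J_reflection, hJ, MulChar.mul_apply B']
    linear_combination ((Fintype.card F : ℂ) - 1) * J B' (A⁻¹ * C)⁻¹ *
      (mulChar_neg_one_mul_self (C * lam) * (B' (-1) * B' (-1)) + mulChar_neg_one_mul_self B')
  have outer := sum_binom_mul_binom (B⁻¹ * (B'⁻¹ * C)) (B'⁻¹ * C) A x
  rw [hQ] at outer
  have hsum : ∑ lam : MulChar F ℂ, ∑ mu : MulChar F ℂ,
      binom (B⁻¹ * B'⁻¹ * C) (B'⁻¹ * C * lam) * binom (A * lam) lam *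
        binom (A * lam * mu) mu * binom (B'⁻¹ * C * lam) (C * lam * mu) *
        lam (-x) * mu (-1) =
      (∑ lam : MulChar F ℂ, binom (B⁻¹ * (B'⁻¹ * C)) (B'⁻¹ * C * lam) * binom (A * lam) lam *
        lam (-x)) * (((Fintype.card F : ℂ) - 1) * J B' (A⁻¹ * C)⁻¹) := by
    rw [sum_mul]
    refine sum_congr rfl fun lam _ ↦ ?_
    rw [← inner lam, mul_sum, hP]
    exact sum_congr rfl fun mu _ ↦ by ring
  have hq : (Fintype.card F : ℂ) - 1 ≠ 0 :=
    sub_ne_zero.mpr (by exact_mod_cast Fintype.one_lt_card.ne')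
  rw [hsum, outer, mul_comm C B'⁻¹, binom]
  simp only [MulChar.mul_apply, mulChar_inv_neg_one]
  field_simp
  linear_combination -(B' (-1) * C (-1) * J B' (A⁻¹ * C)⁻¹ * twoF1 A B (B'⁻¹ * C) x) *
    mulChar_neg_one_mul_self A

end FFAppell
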